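/- arXiv:0810.0041 — 3 statements merged into one kernel-verified Lean document; each statement's English description precedes it below -/
import Mathlib

section
/- If N is a δ-coclosed submodule of M, then δ(N) = N ∩ δ(M), where δ(M) denotes the sum of all δ-small submodules of M. -/
open Submodule

section Defs

universe u v

variable (R : Type u) [Ring R]

/-- A submodule `L` is essential in `M` if it intersects every nonzero submodule nontrivially. -/
def IsEssentialSub {M : Type v} [AddCommGroup M] [Module R M] (L : Submodule R M) : Prop :=
  ∀ K : Submodule R M, K ≠ ⊥ → L ⊓ K ≠ ⊥

/-- A module is singular if it is isomorphic to `N ⧸ L` for some module `N` and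
essential submodule `L ≤ N`. -/
def IsSingular (M : Type v) [AddCommGroup M] [Module R M] : Prop :=
  ∃ (N : Type v) (_ : AddCommGroup N) (_ : Module R N) (L : Submodule R N),
    IsEssentialSub R L ∧ Nonempty ((N ⧸ L) ≃ₗ[R] M)

variable {M : Type v} [AddCommGroup M] [Module R M]

/-- `N` is small in `M`: `N + Z ≠ M` for every proper submodule `Z`. -/
def SmallSub (N : Submodule R M) : Prop :=
  ∀ Z : Submodule R M, Z ≠ ⊤ → N ⊔ Z ≠ ⊤

/-- `N` is δ-small in `M`: `N + Z ≠ M` for every proper submodule `Z` with `M ⧸ Z` singular. -/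
def DeltaSmall (N : Submodule R M) : Prop :=
  ∀ Z : Submodule R M, Z ≠ ⊤ → IsSingular R (M ⧸ Z) → N ⊔ Z ≠ ⊤

/-- `δ(M)`: the sum of all δ-small submodules of `M`. -/
def deltaRad : Submodule R M := sSup {N : Submodule R M | DeltaSmall R N}

/-- The radical: intersection of all maximal submodules. -/
def radM : Submodule R M := sInf {K : Submodule R M | IsCoatom K}

/-- The socle: sum of all simple submodules. -/
def socM : Submodule R M := sSup {S : Submodule R M | IsAtom S}

/-- `N` is a δ-supplement of `K` in `M`: `N + K = M` and `N ∩ K` is δ-small in `N`. -/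
def IsDeltaSupplement (N K : Submodule R M) : Prop :=
  N ⊔ K = ⊤ ∧ DeltaSmall R ((N ⊓ K).comap N.subtype)

/-- `N` is a δ-supplement submodule of `M`. -/
def IsDeltaSupplementSub (N : Submodule R M) : Prop :=
  ∃ K : Submodule R M, IsDeltaSupplement R N K

/-- `N` is a supplement of `K` in `M`: `N + K = M` and `N ∩ K` is small in `N`. -/
def IsSupplement (N K : Submodule R M) : Prop :=
  N ⊔ K = ⊤ ∧ SmallSub R ((N ⊓ K).comap N.subtype)

/-- `M` is δ-supplemented: every submodule has a δ-supplement. -/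
def DeltaSupplemented (M : Type v) [AddCommGroup M] [Module R M] : Prop :=
  ∀ L : Submodule R M, ∃ N : Submodule R M, IsDeltaSupplement R N L

/-- `M` is supplemented: every submodule has a supplement. -/
def Supplemented (M : Type v) [AddCommGroup M] [Module R M] : Prop :=
  ∀ L : Submodule R M, ∃ N : Submodule R M, IsSupplement R N L

/-- `N` is δ-coclosed in `M`: if `X ≤ N`, `N/X` is singular and `N/X ≪_δ M/X`, then `X = N`. -/
def DeltaCoclosed (N : Submodule R M) : Prop :=
  ∀ X : Submodule R M, X ≤ N →
    IsSingular R ↥(N.map X.mkQ) → DeltaSmall R (N.map X.mkQ) → X = N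

/-- `N` is coclosed in `M`: if `X ≤ N` and `N/X ≪ M/X`, then `X = N`. -/
def Coclosed (N : Submodule R M) : Prop :=
  ∀ X : Submodule R M, X ≤ N → SmallSub R (N.map X.mkQ) → X = N

/-- A module is local if it has a largest proper submodule. -/
def LocalModule (M : Type v) [AddCommGroup M] [Module R M] : Prop :=
  ∃ L : Submodule R M, L ≠ ⊤ ∧ ∀ K : Submodule R M, K ≠ ⊤ → K ≤ L

/-- `M` is δ-local if `δ(M)` is δ-small in `M` and `δ(M)` is a maximal submodule. -/
def DeltaLocal (M : Type v) [AddCommGroup M] [Module R M] : Prop :=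
  DeltaSmall R (deltaRad R : Submodule R M) ∧ IsCoatom (deltaRad R : Submodule R M)

end Defs

section Lemmas

universe u v

variable {R : Type u} [Ring R] {A B : Type v} [AddCommGroup A] [Module R A]
  [AddCommGroup B] [Module R B]

theorem isSingular_iff_exists_surjective :
    IsSingular R B ↔ ∃ (P : Type v) (_ : AddCommGroup P) (_ : Module R P) (g : P →ₗ[R] B),
      Function.Surjective g ∧ IsEssentialSub R (LinearMap.ker g) := by
  constructor
  · rintro ⟨P, _, _, L, hL, ⟨e⟩⟩
    refine ⟨P, _, _, e.toLinearMap ∘ₗ L.mkQ, e.surjective.comp L.mkQ_surjective, ?_⟩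
    rwa [LinearEquiv.ker_comp, ker_mkQ]
  · rintro ⟨P, _, _, g, hg, hL⟩
    exact ⟨P, _, _, _, hL, ⟨g.quotKerEquivOfSurjective hg⟩⟩

theorem IsEssentialSub.mono {K L : Submodule R A} (hK : IsEssentialSub R K) (hKL : K ≤ L) :
    IsEssentialSub R L :=
  fun T hT h => hK T hT (le_bot_iff.mp ((inf_le_inf_right T hKL).trans h.le))

theorem IsEssentialSub.comap_subtype {L : Submodule R A} (hL : IsEssentialSub R L)
    (P : Submodule R A) : IsEssentialSub R (L.comap P.subtype) := by
  intro K hK h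
  refine hL (K.map P.subtype) ?_ ?_
  · exact fun h0 => hK (map_injective_of_injective P.injective_subtype
      (h0.trans (Submodule.map_bot _).symm))
  · refine (Submodule.eq_bot_iff _).mpr ?_
    rintro _ ⟨hyL, y, hyK, rfl⟩
    have hy : y ∈ L.comap P.subtype ⊓ K := ⟨hyL, hyK⟩
    rw [h, mem_bot] at hy
    rw [hy, map_zero]

theorem IsSingular.of_surjective (hA : IsSingular R A) (f : A →ₗ[R] B)
    (hf : Function.Surjective f) : IsSingular R B := by
  rw [isSingular_iff_exists_surjective] at hA ⊢
  obtain ⟨P, _, _, g, hg, hL⟩ := hA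
  exact ⟨P, _, _, f ∘ₗ g, hf.comp hg, hL.mono (LinearMap.ker_le_ker_comp g f)⟩

theorem IsSingular.of_injective (hB : IsSingular R B) (f : A →ₗ[R] B)
    (hf : Function.Injective f) : IsSingular R A := by
  rw [isSingular_iff_exists_surjective] at hB
  obtain ⟨P, _, _, g, hg, hL⟩ := hB
  suffices h : IsSingular R (LinearMap.range f) from
    h.of_surjective (LinearEquiv.ofInjective f hf).symm.toLinearMap
      (LinearEquiv.ofInjective f hf).symm.surjective
  rw [isSingular_iff_exists_surjective]
  let g' : (LinearMap.range f).comap g →ₗ[R] LinearMap.range f := g.restrict fun _ hx => hx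
  refine ⟨(LinearMap.range f).comap g, _, _, g', ?_, ?_⟩
  · rintro ⟨b, hb⟩
    obtain ⟨p, rfl⟩ := hg b
    exact ⟨⟨p, hb⟩, rfl⟩
  · refine (hL.comap_subtype _).mono fun x hx => ?_
    exact Subtype.ext hx

theorem DeltaSmall.mono {S T : Submodule R A} (hT : DeltaSmall R T) (h : S ≤ T) :
    DeltaSmall R S :=
  fun Z hZ hs hS => hT Z hZ hs (top_le_iff.mp (hS.ge.trans (sup_le_sup_right h Z)))

theorem DeltaSmall.sup {S T : Submodule R A} (hS : DeltaSmall R S) (hT : DeltaSmall R T) :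
    DeltaSmall R (S ⊔ T) := by
  intro Z hZ hs h
  rw [sup_assoc] at h
  exact hS (T ⊔ Z) (hT Z hZ hs)
    (hs.of_surjective (factor le_sup_right) (factor_surjective le_sup_right)) h

theorem DeltaSmall.map {S : Submodule R A} (hS : DeltaSmall R S) (f : A →ₗ[R] B) :
    DeltaSmall R (S.map f) := by
  intro Z hZ hs h
  have hsup : S ⊔ Z.comap f = ⊤ := by
    refine eq_top_iff.mpr fun a _ => ?_
    have ha : f a ∈ S.map f ⊔ Z := h ▸ mem_top
    obtain ⟨_, ⟨s, hsS, rfl⟩, z, hz, hsz⟩ := mem_sup.mp ha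
    refine mem_sup.mpr ⟨s, hsS, a - s, ?_, by abel⟩
    rwa [mem_comap, map_sub, ← hsz, add_sub_cancel_left]
  have hsing : IsSingular R (A ⧸ Z.comap f) := by
    refine hs.of_injective (mapQ (Z.comap f) Z f le_rfl) ?_
    rw [← LinearMap.ker_eq_bot, mapQ, ker_liftQ_eq_bot]
    rw [LinearMap.ker_comp, ker_mkQ]
  refine hS (Z.comap f) (fun htop => hZ ?_) hsing hsup
  rwa [sup_eq_right.mpr (map_le_iff_le_comap.mpr (htop ▸ le_top))] at h

theorem mem_deltaRad_iff {x : A} : x ∈ deltaRad R (M := A) ↔ DeltaSmall R (R ∙ x) := by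
  constructor
  · intro hx
    have hne : {S : Submodule R A | DeltaSmall R S}.Nonempty :=
      ⟨⊥, fun Z hZ _ h => hZ (by rwa [bot_sup_eq] at h)⟩
    have hdir : DirectedOn (· ≤ ·) {S : Submodule R A | DeltaSmall R S} :=
      fun S hS T hT => ⟨S ⊔ T, DeltaSmall.sup hS hT, le_sup_left, le_sup_right⟩
    obtain ⟨S, hS, hxS⟩ := (mem_sSup_of_directed hne hdir).mp hx
    exact DeltaSmall.mono hS ((span_singleton_le_iff_mem x S).mpr hxS)
  · exact fun h => (le_sSup (a := R ∙ x) h) (mem_span_singleton_self x)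

theorem map_deltaRad_le (f : A →ₗ[R] B) :
    (deltaRad R (M := A)).map f ≤ deltaRad R (M := B) := by
  rintro _ ⟨x, hx, rfl⟩
  have h := (mem_deltaRad_iff.mp hx).map f
  rw [Submodule.map_span, Set.image_singleton] at h
  exact mem_deltaRad_iff.mpr h

/-- A submodule of a δ-coclosed `N` that is δ-small in the ambient module is δ-small in `N`. -/
theorem DeltaCoclosed.deltaSmall_of_map {N : Submodule R A} (hN : DeltaCoclosed R N)
    {S : Submodule R N} (hS : DeltaSmall R (S.map N.subtype)) : DeltaSmall R S := by
  intro Z hZ hs h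
  have hmap : S.map N.subtype ⊔ Z.map N.subtype = N := by
    rw [← Submodule.map_sup, h, Submodule.map_top, range_subtype]
  have hZN : Z.map N.subtype = N := by
    refine hN _ (map_subtype_le N Z) ?_ ?_
    · let q : N →ₗ[R] N.map (Z.map N.subtype).mkQ :=
        (Z.map N.subtype).mkQ.restrict fun _ hx => mem_map_of_mem hx
      have hq : Z ≤ LinearMap.ker q := fun z hz =>
        Subtype.ext ((Quotient.mk_eq_zero _).mpr (mem_map_of_mem (f := N.subtype) hz))
      refine hs.of_surjective (Z.liftQ q hq) ?_
      rintro ⟨_, n, hn, rfl⟩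
      exact ⟨Z.mkQ ⟨n, hn⟩, rfl⟩
    · refine (hS.map (Z.map N.subtype).mkQ).mono ?_
      refine (Submodule.map_mono hmap.ge).trans ?_
      rw [Submodule.map_sup, mkQ_map_self, sup_bot_eq]
  refine hZ (map_injective_of_injective N.injective_subtype ?_)
  rw [hZN, Submodule.map_top, range_subtype]

end Lemmas

theorem deltaRad_of_deltaCoclosed {R : Type*} [Ring R] {M : Type*} [AddCommGroup M]
    [Module R M] (N : Submodule R M) (hN : DeltaCoclosed R N) :
    Submodule.map N.subtype (deltaRad R : Submodule R N) = N ⊓ deltaRad R := by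
  refine le_antisymm (le_inf (map_subtype_le N _) (map_deltaRad_le N.subtype)) ?_
  rintro x ⟨hxN, hx⟩
  refine ⟨⟨x, hxN⟩, mem_deltaRad_iff.mpr (hN.deltaSmall_of_map ?_), rfl⟩
  rw [Submodule.map_span, Set.image_singleton]
  exact mem_deltaRad_iff.mp hx
end

section
/- Every projective, semilocal, δ-supplemented module with small radical is supplemented. -/
open Submodule

section Helpers

universe u v w

variable {R : Type u} [Ring R] {M : Type v} [AddCommGroup M] [Module R M]

theorem SmallSub.mono {A B : Submodule R M} (hB : SmallSub R B) (hAB : A ≤ B) :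
    SmallSub R A := fun Z hZ h =>
  hB Z hZ (top_le_iff.mp (h ▸ sup_le_sup_right hAB Z))

theorem SmallSub.map {M' : Type w} [AddCommGroup M'] [Module R M'] {A : Submodule R M}
    (hA : SmallSub R A) (f : M →ₗ[R] M') : SmallSub R (A.map f) := by
  intro Z hZ h
  have hcomap : Z.comap f = ⊤ := by
    by_contra hne
    refine hA _ hne (eq_top_iff'.mpr fun m => ?_)
    obtain ⟨_, ⟨a, ha, rfl⟩, z, hz, hm⟩ := mem_sup.mp (h ▸ mem_top : f m ∈ A.map f ⊔ Z)
    refine mem_sup.mpr ⟨a, ha, m - a, ?_, by abel⟩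
    rw [mem_comap, map_sub, ← hm, add_sub_cancel_left]
    exact hz
  have hle : A.map f ≤ Z := map_le_iff_le_comap.mpr (hcomap ▸ le_top)
  exact hZ (by rwa [sup_eq_right.mpr hle] at h)

/-- Every submodule `X` has a maximal disjoint submodule inside a given submodule `K`. -/
theorem exists_maximal_disjoint_le (K X : Submodule R M) :
    ∃ Y : Submodule R M, Maximal (fun Y => Y ≤ K ∧ Disjoint X Y) Y := by
  obtain ⟨Y, -, hY⟩ := zorn_le_nonempty₀ {Y : Submodule R M | Y ≤ K ∧ Disjoint X Y}
    (fun c hc hchain y hy => ⟨sSup c, ⟨sSup_le fun Z hZ => (hc hZ).1,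
      (hchain.directedOn.disjoint_sSup_right).mpr fun Z hZ => (hc hZ).2⟩,
      fun Z hZ => le_sSup hZ⟩) ⊥ ⟨bot_le, disjoint_bot_right⟩
  exact ⟨Y, hY⟩

/-- If `K` is δ-small and `X + K` is the whole module, then `X` is a direct summand. -/
theorem DeltaSmall.exists_isCompl {K X : Submodule R M} (hK : DeltaSmall R K)
    (hXK : X ⊔ K = ⊤) : ∃ Y ≤ K, IsCompl X Y := by
  obtain ⟨Y, ⟨hYK, hXY⟩, hmax⟩ := exists_maximal_disjoint_le K X
  refine ⟨Y, hYK, hXY, codisjoint_iff.mpr ?_⟩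
  by_contra hne
  refine hK (X ⊔ Y) hne ?_ (top_le_iff.mp (hXK ▸ sup_le (le_sup_left.trans le_sup_right)
    le_sup_left))
  let g : K →ₗ[R] M ⧸ (X ⊔ Y) := (X ⊔ Y).mkQ ∘ₗ K.subtype
  have hg : Function.Surjective g := by
    intro q
    obtain ⟨m, rfl⟩ := (X ⊔ Y).mkQ_surjective q
    obtain ⟨x, hx, k, hk, rfl⟩ := mem_sup.mp (hXK ▸ mem_top : m ∈ X ⊔ K)
    refine ⟨⟨k, hk⟩, ?_⟩
    have hx0 : (X ⊔ Y).mkQ x = 0 := by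
      simpa using (le_sup_left : X ≤ X ⊔ Y) hx
    simp [g, map_add, hx0]
  refine ⟨K, inferInstance, inferInstance, LinearMap.ker g, ?_,
    ⟨g.quotKerEquivOfSurjective hg⟩⟩
  intro U hU hdisj
  have hker : ∀ k : K, k ∈ U → (k : M) ∈ X ⊔ Y → k = 0 := by
    intro k hkU hk
    have hmem : k ∈ LinearMap.ker g ⊓ U := ⟨by simpa [g] using hk, hkU⟩
    rwa [hdisj, mem_bot] at hmem
  have hUY : Y ⊔ U.map K.subtype ≤ Y := by
    refine hmax ⟨sup_le hYK (map_subtype_le K U), ?_⟩ le_sup_left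
    rw [disjoint_def]
    rintro x hx hxU
    obtain ⟨y, hy, _, ⟨k, hk, rfl⟩, rfl⟩ := mem_sup.mp hxU
    have hk0 : k = 0 := hker k hk (mem_sup.mpr ⟨_, hx, -y, neg_mem hy, by simp⟩)
    subst hk0
    simp only [map_zero, add_zero] at hx ⊢
    exact disjoint_def.mp hXY y hx hy
  refine hU (_root_.eq_bot_iff.mpr fun k hk => ?_)
  exact hker k hk ((le_sup_right.trans (hUY.trans le_sup_right)) ⟨k, hk, rfl⟩)

/-- If `M ⧸ A` is semisimple, then every submodule has a weak supplement modulo `A`. -/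
theorem exists_sup_eq_top_inf_le (A L : Submodule R M) [IsSemisimpleModule R (M ⧸ A)] :
    ∃ W : Submodule R M, W ⊔ L = ⊤ ∧ W ⊓ L ≤ A := by
  obtain ⟨C, hC⟩ := exists_isCompl (L.map A.mkQ)
  refine ⟨C.comap A.mkQ, ?_, ?_⟩
  · refine eq_top_iff'.mpr fun m => ?_
    obtain ⟨_, ⟨l, hl, rfl⟩, c, hc, hm⟩ :=
      mem_sup.mp (hC.sup_eq_top ▸ mem_top : A.mkQ m ∈ L.map A.mkQ ⊔ C)
    refine mem_sup.mpr ⟨m - l, ?_, l, hl, by abel⟩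
    rw [mem_comap, map_sub, ← hm, add_sub_cancel_left]
    exact hc
  · rintro x ⟨hxC, hxL⟩
    have h0 := disjoint_def.mp hC.disjoint (A.mkQ x) ⟨x, hxL, rfl⟩ hxC
    simpa using h0

end Helpers

theorem projective_semilocal_deltaSupplemented_is_supplemented {R : Type*} [Ring R]
    (M : Type*) [AddCommGroup M] [Module R M] [Module.Projective R M]
    (hsl : IsSemisimpleModule R (M ⧸ (radM R : Submodule R M)))
    (hds : DeltaSupplemented R M) (hrad : SmallSub R (radM R : Submodule R M)) :
    Supplemented R M := by
  intro L
  obtain ⟨N, hNL, hδ⟩ := hds L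
  obtain ⟨W, hWL, hWrad⟩ := exists_sup_eq_top_inf_le (radM R) L
  have hsurj : Function.Surjective (L.mkQ ∘ₗ N.subtype) := by
    intro q
    obtain ⟨m, rfl⟩ := L.mkQ_surjective q
    obtain ⟨n, hn, l, hl, rfl⟩ := mem_sup.mp (hNL ▸ mem_top : m ∈ N ⊔ L)
    exact ⟨⟨n, hn⟩, by simpa using hl⟩
  obtain ⟨f, hf⟩ := Module.projective_lifting_property _ L.mkQ hsurj
  have hfL (m : M) : m - f m ∈ L := by
    have h := LinearMap.congr_fun hf m
    exact (Submodule.Quotient.eq L).mp h.symm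
  have hfW (m : M) : ∃ w ∈ W, m - f w ∈ L := by
    obtain ⟨w, hw, l, hl, rfl⟩ := mem_sup.mp (hWL ▸ mem_top : m ∈ W ⊔ L)
    refine ⟨w, hw, ?_⟩
    rw [add_sub_right_comm]
    exact add_mem (hfL w) hl
  have hsup : W.map f ⊔ (N ⊓ L).comap N.subtype = ⊤ := by
    refine eq_top_iff'.mpr fun n => ?_
    obtain ⟨w, hw, h⟩ := hfW n
    exact mem_sup.mpr ⟨f w, ⟨w, hw, rfl⟩, n - f w, ⟨(n - f w).2, h⟩, by abel⟩
  obtain ⟨Y, -, hY⟩ := hδ.exists_isCompl hsup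
  let q : N →ₗ[R] (W.map f).map N.subtype :=
    N.subtype.submoduleMap (W.map f) ∘ₗ (W.map f).projectionOnto Y hY
  refine ⟨(W.map f).map N.subtype, ?_, ((hrad.map f).map q).mono ?_⟩
  · refine eq_top_iff'.mpr fun m => ?_
    obtain ⟨w, hw, h⟩ := hfW m
    exact mem_sup.mpr ⟨f w, ⟨f w, ⟨w, hw, rfl⟩, rfl⟩, m - f w, h, by abel⟩
  · rintro ⟨_, _, ⟨w, hw, rfl⟩, rfl⟩ ⟨-, hL⟩
    have hwL : w ∈ L := by
      have h := add_mem (hfL w) hL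
      simpa using h
    refine ⟨f w, ⟨w, hWrad ⟨hw, hwL⟩, rfl⟩, Subtype.ext ?_⟩
    have hproj := projectionOnto_apply_left hY ⟨f w, ⟨w, hw, rfl⟩⟩
    exact congrArg (fun x : W.map f => ((x : N) : M)) hproj
end

section
/- A ring R with J = Jac(R) and S = Soc(ᵣR) is semiperfect if and only if R is δ-semiperfect and S/(S ∩ J) is finitely generated. -/
open Submodule

section Semisimple

variable {R : Type*} [Ring R] {M : Type*} [AddCommGroup M] [Module R M]

theorem isSemisimpleModule_quotient_of_exists_sup_eq_top {A : Submodule R M}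
    (h : ∀ L : Submodule R M, A ≤ L → ∃ N : Submodule R M, N ⊔ L = ⊤ ∧ N ⊓ L ≤ A) :
    IsSemisimpleModule R (M ⧸ A) where
  exists_isCompl W := by
    have hAW : A ≤ W.comap A.mkQ := by
      intro x hx
      have : A.mkQ x = 0 := by simpa using hx
      simp [Submodule.mem_comap, this]
    obtain ⟨N, hsup, hinf⟩ := h (W.comap A.mkQ) hAW
    refine ⟨N.map A.mkQ, ?_, ?_⟩
    · rw [Submodule.disjoint_def]
      rintro x hxW ⟨y, hy, rfl⟩
      simpa using hinf ⟨hy, hxW⟩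
    · rw [codisjoint_iff, eq_top_iff]
      rintro x -
      obtain ⟨y, rfl⟩ := A.mkQ_surjective x
      have hy : y ∈ N ⊔ W.comap A.mkQ := hsup ▸ Submodule.mem_top
      obtain ⟨a, ha, b, hb, rfl⟩ := Submodule.mem_sup.1 hy
      rw [map_add, add_comm]
      exact Submodule.add_mem_sup hb (Submodule.mem_map_of_mem ha)

theorem isSemisimpleModule_quotient_of_le {A B : Submodule R M} (hAB : A ≤ B)
    [IsSemisimpleModule R (M ⧸ A)] : IsSemisimpleModule R (M ⧸ B) :=
  .of_surjective (Submodule.factor hAB) (Submodule.factor_surjective hAB)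

theorem isSemisimpleModule_quotient_inf (A B : Submodule R M)
    [IsSemisimpleModule R (M ⧸ A)] [IsSemisimpleModule R (M ⧸ B)] :
    IsSemisimpleModule R (M ⧸ (A ⊓ B)) := by
  refine isSemisimpleModule_quotient_of_exists_sup_eq_top fun L hL ↦ ?_
  obtain ⟨P, hP⟩ := exists_isCompl ((L ⊔ A).map A.mkQ)
  obtain ⟨Q, hQ⟩ := exists_isCompl ((L ⊓ A).map B.mkQ)
  have key : ∀ {C X : Submodule R M} {T : Submodule R (M ⧸ C)}, IsCompl (X.map C.mkQ) T →
      X ⊔ T.comap C.mkQ = ⊤ ∧ X ⊓ T.comap C.mkQ ≤ C := by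
    intro C X T hT
    constructor
    · rw [eq_top_iff]
      rintro x -
      have hx : C.mkQ x ∈ X.map C.mkQ ⊔ T := hT.sup_eq_top ▸ Submodule.mem_top
      obtain ⟨_, ⟨a, ha, rfl⟩, t, ht, hat⟩ := Submodule.mem_sup.1 hx
      refine Submodule.mem_sup.2 ⟨a, ha, x - a, ?_, by abel⟩
      rw [Submodule.mem_comap, map_sub, ← hat, add_sub_cancel_left]
      exact ht
    · rintro x ⟨hxX, hxT⟩
      simpa using Submodule.disjoint_def.1 hT.disjoint _ (Submodule.mem_map_of_mem hxX) hxT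
  obtain ⟨hP1, hP2⟩ := key hP
  obtain ⟨hQ1, hQ2⟩ := key hQ
  set P' := P.comap A.mkQ with hP'
  set Q' := Q.comap B.mkQ
  have hAP : A ≤ P' := by
    intro x hx
    have : A.mkQ x = 0 := by simpa using hx
    simp [hP', Submodule.mem_comap, this]
  refine ⟨P' ⊓ Q', ?_, ?_⟩
  · rw [eq_top_iff]
    rintro x -
    obtain ⟨l, hl, p, hp, rfl⟩ := Submodule.mem_sup.1
      (show x ∈ (L ⊔ A) ⊔ P' from hP1 ▸ Submodule.mem_top)
    obtain ⟨m, hm, a, ha, rfl⟩ := Submodule.mem_sup.1 hl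
    obtain ⟨c, hc, q, hq, hcq⟩ := Submodule.mem_sup.1
      (show a + p ∈ (L ⊓ A) ⊔ Q' from hQ1 ▸ Submodule.mem_top)
    refine Submodule.mem_sup.2 ⟨q, ⟨?_, hq⟩, m + c, add_mem hm hc.1, ?_⟩
    · rw [show q = a + p - c from eq_sub_of_add_eq' hcq]
      exact sub_mem (add_mem (hAP ha) hp) (hAP hc.2)
    · rw [add_assoc m, ← hcq]; abel
  · rintro x ⟨⟨hxP, hxQ⟩, hxL⟩
    have hxA : x ∈ A := hP2 ⟨le_sup_left (a := L) hxL, hxP⟩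
    exact ⟨hxA, hQ2 ⟨⟨hxL, hxA⟩, hxQ⟩⟩

end Semisimple

section Essential

universe u v

variable {R : Type u} [Ring R] {M : Type v} [AddCommGroup M] [Module R M]

theorem exists_disjoint_isEssentialSub_sup (Z : Submodule R M) :
    ∃ C : Submodule R M, Disjoint Z C ∧ IsEssentialSub R (Z ⊔ C) := by
  obtain ⟨C, hC⟩ := zorn_le₀ {C : Submodule R M | Disjoint Z C} (fun c hc hchain ↦
    ⟨sSup c, (hchain.directedOn.disjoint_sSup_right).2 (fun {b} hb ↦ hc hb),
      fun _ hz ↦ le_sSup hz⟩)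
  refine ⟨C, hC.1, fun K hK hinf ↦ hK ?_⟩
  have hd : Disjoint Z (C ⊔ K) :=
    Disjoint.disjoint_sup_right_of_disjoint_sup_left hC.1 (disjoint_iff.2 hinf)
  have hKC : K ≤ C := le_sup_right.trans (hC.2 hd le_sup_left)
  rw [← hinf, inf_eq_right.2 (hKC.trans le_sup_right)]

theorem IsEssentialSub.isSingular_quotient {L : Submodule R M} (hL : IsEssentialSub R L) :
    IsSingular R (M ⧸ L) :=
  ⟨M, inferInstance, inferInstance, L, hL, ⟨.refl R _⟩⟩

theorem IsSingular.congr {M' : Type v} [AddCommGroup M'] [Module R M']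
    (h : IsSingular R M) (e : M ≃ₗ[R] M') : IsSingular R M' := by
  obtain ⟨N, i, j, L, hL, ⟨f⟩⟩ := h
  exact ⟨N, i, j, L, hL, ⟨f.trans e⟩⟩

theorem SmallSub.deltaSmall {X : Submodule R M} (h : SmallSub R X) : DeltaSmall R X :=
  fun Z hZ _ ↦ h Z hZ

theorem DeltaSmall.exists_isCompl_s17 {X Z : Submodule R M} (hX : DeltaSmall R X)
    (hXZ : X ⊔ Z = ⊤) : ∃ C, IsCompl Z C := by
  obtain ⟨C, hd, he⟩ := exists_disjoint_isEssentialSub_sup Z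
  refine ⟨C, hd, codisjoint_iff.2 ?_⟩
  by_contra hne
  refine hX _ hne he.isSingular_quotient (eq_top_iff.2 ?_)
  rw [← hXZ]
  exact sup_le_sup_left le_sup_left X

theorem DeltaSmall.isSemisimpleModule_quotient {X Z : Submodule R M} (hX : DeltaSmall R X)
    (hXZ : X ⊔ Z = ⊤) : IsSemisimpleModule R (M ⧸ Z) := by
  refine isSemisimpleModule_quotient_of_exists_sup_eq_top fun L hL ↦ ?_
  obtain ⟨C, hC⟩ := hX.exists_isCompl_s17 (Z := L)
    (eq_top_iff.2 (hXZ ▸ sup_le_sup_left hL X))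
  exact ⟨C, hC.symm.sup_eq_top, hC.symm.inf_eq_bot ▸ bot_le⟩

theorem comap_subtype_sup_eq_top {N X Z : Submodule R M} (hXN : X ≤ N) (h : N ≤ X ⊔ Z) :
    X.comap N.subtype ⊔ Z.comap N.subtype = ⊤ := by
  rw [eq_top_iff]
  rintro ⟨n, hn⟩ -
  obtain ⟨x, hx, z, hz, hxz⟩ := Submodule.mem_sup.1 (h hn)
  have hzN : z ∈ N := by
    rw [show z = n - x from eq_sub_of_add_eq' hxz]
    exact sub_mem hn (hXN hx)
  exact Submodule.mem_sup.2 ⟨⟨x, hXN hx⟩, hx, ⟨z, hzN⟩, hz, Subtype.ext hxz⟩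

theorem SmallSub.of_comap_subtype {N X : Submodule R M} (hXN : X ≤ N)
    (hX : SmallSub R (X.comap N.subtype)) : SmallSub R X := by
  intro Z hZ hXZ
  have hNZ : N ≤ Z := by
    by_contra hne
    exact hX (Z.comap N.subtype) (fun h ↦ hne (Submodule.comap_subtype_eq_top.1 h))
      (comap_subtype_sup_eq_top hXN (hXZ ▸ le_top))
  exact hZ (by rw [← hXZ, sup_eq_right.2 (hXN.trans hNZ)])

theorem DeltaSmall.of_comap_subtype {N X : Submodule R M} (hXN : X ≤ N)
    (hX : DeltaSmall R (X.comap N.subtype)) : DeltaSmall R X := by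
  intro Z hZ hsing hXZ
  have hNZ : N ≤ Z := by
    by_contra hne
    refine hX (Z.comap N.subtype) (fun h ↦ hne (Submodule.comap_subtype_eq_top.1 h)) ?_
      (comap_subtype_sup_eq_top hXN (hXZ ▸ le_top))
    have hsurj : Function.Surjective (Z.mkQ ∘ₗ N.subtype) := by
      intro y
      obtain ⟨y, rfl⟩ := Z.mkQ_surjective y
      obtain ⟨x, hx, z, hz, rfl⟩ := Submodule.mem_sup.1
        (show y ∈ X ⊔ Z from hXZ ▸ Submodule.mem_top)
      refine ⟨⟨x, hXN hx⟩, ?_⟩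
      have : Z.mkQ z = 0 := by simpa using hz
      rw [map_add, this, add_zero]
      rfl
    have hker : Z.comap N.subtype = LinearMap.ker (Z.mkQ ∘ₗ N.subtype) := by
      rw [LinearMap.ker_comp, Submodule.ker_mkQ]
    rw [hker]
    exact hsing.congr ((Z.mkQ ∘ₗ N.subtype).quotKerEquivOfSurjective hsurj).symm
  exact hZ (by rw [← hXZ, sup_eq_right.2 (hXN.trans hNZ)])

theorem SmallSub.le_radM {X : Submodule R M} (hX : SmallSub R X) : X ≤ radM R :=
  le_sInf fun K hK ↦ by
    by_contra hne
    exact hX K hK.1 (hK.2 _ (right_lt_sup.2 hne))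

theorem Supplemented.isSemisimpleModule_quotient_radM (h : Supplemented R M) :
    IsSemisimpleModule R (M ⧸ (radM R : Submodule R M)) :=
  isSemisimpleModule_quotient_of_exists_sup_eq_top fun L _ ↦
    have ⟨N, hsup, hsmall⟩ := h L
    ⟨N, hsup, (SmallSub.of_comap_subtype inf_le_left hsmall).le_radM⟩

theorem isSupplement_of_minimal {Z L : Submodule R M} (hZL : Z ⊔ L = ⊤)
    (hmin : ∀ W ≤ Z, W ⊔ L = ⊤ → Z ≤ W) : IsSupplement R Z L := by
  refine ⟨hZL, fun W hW hsup ↦ hW (eq_top_iff.2 ?_)⟩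
  have hZ : Z ⊓ L ⊔ W.map Z.subtype = Z := by
    have := congrArg (Submodule.map Z.subtype) hsup
    rwa [Submodule.map_sup, Submodule.map_comap_subtype, ← inf_assoc, inf_idem,
      Submodule.map_top, Submodule.range_subtype] at this
  have hle : Z ≤ W.map Z.subtype := by
    refine hmin _ (Submodule.map_subtype_le Z W) (eq_top_iff.2 ?_)
    rw [← hZL]
    refine sup_le (hZ.symm.le.trans (sup_le (inf_le_right.trans le_sup_right) le_sup_left))
      le_sup_right
  rintro ⟨z, hz⟩ -
  obtain ⟨w, hw, hwz⟩ := hle hz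
  rwa [show (⟨z, hz⟩ : Z) = w from Subtype.ext hwz.symm]

theorem isSemisimpleModule_socM : IsSemisimpleModule R (socM R : Submodule R M) := by
  rw [socM, sSup_eq_iSup]
  refine isSemisimpleModule_biSup_of_isSemisimpleModule_submodule fun T hT ↦ ?_
  have := isSimpleModule_iff_isAtom.2 hT
  infer_instance

theorem map_mem_socM {M' : Type*} [AddCommGroup M'] [Module R M'] (f : M →ₗ[R] M')
    {T : Submodule R M} (hT : IsAtom T) {x : M} (hx : x ∈ T) : f x ∈ (socM R : Submodule R M') := by
  by_cases h0 : T ≤ LinearMap.ker f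
  · rw [LinearMap.mem_ker.1 (h0 hx)]
    exact zero_mem _
  have hatom : IsAtom (T.map f) := by
    refine ⟨fun h ↦ h0 (LinearMap.le_ker_iff_map.2 h), fun K hK ↦ ?_⟩
    have hKT : K = (T ⊓ K.comap f).map f := by
      rw [← Submodule.map_inf_eq_map_inf_comap, inf_eq_right.2 hK.le]
    rcases hT.le_iff.1 (inf_le_left : T ⊓ K.comap f ≤ T) with h | h
    · rw [hKT, h, Submodule.map_bot]
    · exact absurd (h ▸ hKT) hK.ne
  have hle : T.map f ≤ socM R := le_sSup hatom
  exact hle (Submodule.mem_map_of_mem hx)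

end Essential

section Ring

universe u

variable {R : Type u} [Ring R]

theorem smul_mem_of_mem_radM_of_isSemisimpleModule_quotient {M : Type*} [AddCommGroup M]
    [Module R M] {Z : Submodule R M} [IsSemisimpleModule R (M ⧸ Z)] {j : R}
    (hj : j ∈ (radM R : Submodule R R)) (x : M) : j • x ∈ Z := by
  have := Module.mem_annihilator.1 (IsSemisimpleModule.jacobson_le_annihilator R (M ⧸ Z) hj)
    (Z.mkQ x)
  rwa [← map_smul, Submodule.mkQ_apply, Submodule.Quotient.mk_eq_zero] at this

theorem exists_inf_socM_le_radM
    [Module.Finite R (↥(socM R : Submodule R R) ⧸ Submodule.comap (socM R : Submodule R R).subtype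
      ((socM R : Submodule R R) ⊓ (radM R : Submodule R R)))] :
    ∃ C : Submodule R R, IsSemisimpleModule R (R ⧸ C) ∧ C ⊓ socM R ≤ radM R := by
  have := isSemisimpleModule_socM (R := R) (M := R)
  set S : Submodule R R := socM R
  set J : Submodule R R := radM R
  set Q := Submodule.comap S.subtype (S ⊓ J)
  obtain ⟨W, ⟨C, hC, rfl⟩, hmin⟩ := IsArtinian.set_has_minimal
    {W : Submodule R (S ⧸ Q) | ∃ C : Submodule R R, IsSemisimpleModule R (R ⧸ C) ∧
      W = (C.comap S.subtype).map Q.mkQ} ⟨_, ⊤,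
        isSemisimpleModule_quotient_of_exists_sup_eq_top fun L _ ↦ ⟨⊤, top_sup_eq L, le_top⟩, rfl⟩
  refine ⟨C, hC, fun x hx ↦ Submodule.mem_sInf.2 fun K hK ↦ ?_⟩
  have := isSimpleModule_iff_isCoatom.2 hK
  have hle : ((C ⊓ K).comap S.subtype).map Q.mkQ ≤ (C.comap S.subtype).map Q.mkQ :=
    Submodule.map_mono (Submodule.comap_mono inf_le_left)
  have heq := eq_of_le_of_not_lt hle (hmin _ ⟨C ⊓ K, isSemisimpleModule_quotient_inf C K, rfl⟩)
  obtain ⟨y, hy, hyx⟩ := heq.ge (Submodule.mem_map_of_mem (f := Q.mkQ)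
    (show (⟨x, hx.2⟩ : S) ∈ C.comap S.subtype from hx.1))
  have hsub : y - ⟨x, hx.2⟩ ∈ Q := (Submodule.Quotient.eq Q).1 hyx
  have hJK : (y : R) - x ∈ K := Submodule.mem_sInf.1 hsub.2 K hK
  have := sub_mem hy.2 hJK
  simpa using this

theorem mem_radM_of_forall_isEssentialSub {C : Submodule R R} (hC : C ⊓ socM R ≤ radM R) {x : R}
    (hxC : x ∈ C)
    (hx : ∀ K : Submodule R R, IsCoatom K → IsEssentialSub R K → x ∈ K) :
    x ∈ (radM R : Submodule R R) := by
  refine Submodule.mem_sInf.2 fun Z hZ ↦ ?_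
  by_contra hxZ
  have hness : ¬ IsEssentialSub R Z := fun h ↦ hxZ (hx Z hZ h)
  rw [IsEssentialSub] at hness
  push Not at hness
  obtain ⟨T, hT0, hZT⟩ := hness
  have hcompl : IsCompl Z T := ⟨disjoint_iff.2 hZT, codisjoint_iff.2 (hZ.2 _ (left_lt_sup.2
    fun h ↦ hT0 (by rw [← hZT, inf_eq_right.2 h])))⟩
  have hTatom : IsAtom T := hcompl.isCoatom_iff_isAtom.1 hZ
  obtain ⟨z, hz, g, hg, hzg⟩ := Submodule.mem_sup.1
    (show (1 : R) ∈ Z ⊔ T from hcompl.sup_eq_top ▸ Submodule.mem_top)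
  have hmulz : ∀ t ∈ T, t * g = t := by
    intro t ht
    have h1 : t * z + t * g = t := by rw [← mul_add, hzg, mul_one]
    have h2 : t * z ∈ T := by
      rw [eq_sub_of_add_eq h1]
      exact sub_mem ht (T.smul_mem t hg)
    have h3 : t * z = 0 := Submodule.disjoint_def.1 hcompl.disjoint _ (Z.smul_mem t hz) h2
    rwa [h3, zero_add] at h1
  have hxg : x * g ≠ 0 := by
    intro h0
    apply hxZ
    have h1 : x * z + x * g = x := by rw [← mul_add, hzg, mul_one]
    rw [← h1, h0, add_zero]
    exact Z.smul_mem x hz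
  have hspan : Submodule.span R {x * g} = T :=
    (hTatom.le_iff.1 (by
      rw [Submodule.span_singleton_le_iff_mem]
      exact T.smul_mem x hg)).resolve_left (by simpa using hxg)
  obtain ⟨r, hr⟩ := Submodule.mem_span_singleton.1 (hspan.ge hg)
  have hgrx : g * (r * x) ∈ (radM R : Submodule R R) := by
    refine hC ⟨C.smul_mem g (C.smul_mem r hxC), ?_⟩
    exact map_mem_socM (LinearMap.toSpanSingleton R R (r * x)) hTatom hg
  have hgJ : g ∈ Ring.jacobson R := by
    have : g * (r * x) * g ∈ Ring.jacobson R := Ideal.mul_mem_right _ _ hgrx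
    rwa [mul_assoc, mul_assoc, show r * (x * g) = g from hr, hmulz g hg] at this
  have hgZ : g ∈ Z := Submodule.mem_sInf.1 (show g ∈ (radM R : Submodule R R) from hgJ) Z hZ
  apply hxg
  rw [Submodule.disjoint_def.1 hcompl.disjoint g hgZ hg, mul_zero]

theorem DeltaSupplemented.isSemisimpleModule_quotient_radM (h : DeltaSupplemented R R)
    [Module.Finite R (↥(socM R : Submodule R R) ⧸ Submodule.comap (socM R : Submodule R R).subtype
      ((socM R : Submodule R R) ⊓ (radM R : Submodule R R)))] :
    IsSemisimpleModule R (R ⧸ (radM R : Submodule R R)) := by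
  obtain ⟨C, hC, hCS⟩ := exists_inf_socM_le_radM (R := R)
  set D : Submodule R R := sInf {K | IsCoatom K ∧ IsEssentialSub R K}
  have hD : IsSemisimpleModule R (R ⧸ D) := by
    refine isSemisimpleModule_quotient_of_exists_sup_eq_top fun L _ ↦ ?_
    obtain ⟨N, hsup, hsmall⟩ := h L
    refine ⟨N, hsup, le_sInf fun K hK ↦ ?_⟩
    by_contra hne
    exact DeltaSmall.of_comap_subtype inf_le_left hsmall K hK.1.1 hK.2.isSingular_quotient
      (hK.1.2 _ (right_lt_sup.2 hne))
  have := isSemisimpleModule_quotient_inf C D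
  exact isSemisimpleModule_quotient_of_le (A := C ⊓ D) fun x hx ↦
    mem_radM_of_forall_isEssentialSub hCS hx.1 fun K hK hKe ↦ Submodule.mem_sInf.1 hx.2 K ⟨hK, hKe⟩

theorem exists_isSupplement_of_isDeltaSupplement
    [IsSemisimpleModule R (R ⧸ (radM R : Submodule R R))] {N L : Submodule R R}
    (h : IsDeltaSupplement R N L) : ∃ Z, IsSupplement R Z L := by
  set J : Submodule R R := radM R
  have hJN : ∀ Z ≤ N, Z ⊔ L = ⊤ → ∀ j ∈ J, ∀ x ∈ N, j * x ∈ Z := by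
    intro Z hZN hZL j hj x hx
    have hN : N ≤ N ⊓ L ⊔ Z := by
      rw [sup_comm, inf_comm, ← sup_inf_assoc_of_le _ hZN, hZL, top_inf_eq]
    have := h.2.isSemisimpleModule_quotient (comap_subtype_sup_eq_top inf_le_left hN)
    exact smul_mem_of_mem_radM_of_isSemisimpleModule_quotient
      (Z := Z.comap N.subtype) hj (⟨x, hx⟩ : N)
  obtain ⟨n, hn, l, hl, hnl⟩ := Submodule.mem_sup.1
    (show (1 : R) ∈ N ⊔ L from h.1 ▸ Submodule.mem_top)
  set f := LinearMap.toSpanSingleton R R n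
  have hfN : ∀ I : Submodule R R, I.map f ≤ N := by
    rintro I _ ⟨r, -, rfl⟩
    exact N.smul_mem r hn
  obtain ⟨W, hW, hmin⟩ := IsArtinian.set_has_minimal
    {W : Submodule R (R ⧸ J) | (W.comap J.mkQ).map f ⊔ L = ⊤} ⟨⊤, by
      change Submodule.map f (Submodule.comap J.mkQ ⊤) ⊔ L = ⊤
      refine (Ideal.eq_top_iff_one _).2 ?_
      rw [← hnl]
      exact Submodule.add_mem_sup ⟨1, trivial, one_smul R n⟩ hl⟩
  refine ⟨(W.comap J.mkQ).map f, isSupplement_of_minimal hW fun Z hZW hZL ↦ ?_⟩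
  set I := W.comap J.mkQ ⊓ Z.comap f
  have hJI : J ≤ I := by
    refine fun j hj ↦ ⟨?_, hJN Z (hZW.trans (hfN _)) hZL j hj n hn⟩
    have : J.mkQ j = 0 := by simpa using hj
    simp [this]
  have hI : (I.map J.mkQ).comap J.mkQ = I := by
    rw [Submodule.comap_map_mkQ, sup_eq_right.2 hJI]
  have hIZ : I.map f = Z := by
    rw [← Submodule.map_inf_eq_map_inf_comap, inf_eq_right.2 hZW]
  have heq : I.map J.mkQ = W := eq_of_le_of_not_lt
    (Submodule.map_le_iff_le_comap.2 inf_le_left)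
    (hmin _ (by rw [Set.mem_ofPred_eq, hI, hIZ, hZL]))
  rw [← heq, hI, hIZ]

end Ring

theorem semiperfect_iff_deltaSemiperfect_and_socle_fg (R : Type*) [Ring R] :
    Supplemented R R ↔
      DeltaSupplemented R R ∧
        Module.Finite R
          (↥(socM R : Submodule R R) ⧸
            Submodule.comap (socM R : Submodule R R).subtype
              ((socM R : Submodule R R) ⊓ (radM R : Submodule R R))) := by
  constructor
  · intro h
    refine ⟨fun L ↦ ?_, ?_⟩
    · obtain ⟨N, hsup, hsmall⟩ := h L
      exact ⟨N, hsup, hsmall.deltaSmall⟩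
    · have := h.isSemisimpleModule_quotient_radM
      set S : Submodule R R := socM R
      set J : Submodule R R := radM R
      have hker : LinearMap.ker (J.mkQ ∘ₗ S.subtype) = (S ⊓ J).comap S.subtype := by
        rw [LinearMap.ker_comp, Submodule.ker_mkQ, Submodule.comap_inf,
          Submodule.comap_subtype_self, top_inf_eq]
      rw [← hker]
      exact .equiv (J.mkQ ∘ₗ S.subtype).quotKerEquivRange.symm
  · rintro ⟨h, hfin⟩ L
    have := h.isSemisimpleModule_quotient_radM
    obtain ⟨N, hN⟩ := h L
    exact exists_isSupplement_of_isDeltaSupplement hN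
end
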